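/- Induction lemma (Lemma 2 of the paper): Let U be a finite type, f : Finset U → ℝ be monotone and submodular, T ≥ 1, and P^1, …, P^T, G^1, …, G^T ⊆ U be sets such that for every t ∈ {1, …, T}, f(P^t | ⋃_{s<t} P^s) ≥ f(G^t | ⋃_{s<t} P^s). Then f(⋃_{t=1}^T P^t) ≥ f(⋃_{t=1}^T G^t) + Σ_{t=1}^{T−1} [ f(⋃_{s=1}^{t} P^s | ⋃_{s=1}^{t+1} G^s) − f(⋃_{s=1}^{t} P^s | ⋃_{s=1}^{t} G^s) ]. -/

import Mathlib

/-- A set function is submodular if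
`f (A ∪ {e}) - f A ≥ f (B ∪ {e}) - f B` for all `A ⊆ B` and `e ∉ B`. -/
def IsSubmodular {U : Type*} [DecidableEq U] (f : Finset U → ℝ) : Prop :=
  ∀ A B : Finset U, A ⊆ B → ∀ e ∉ B, f (insert e A) - f A ≥ f (insert e B) - f B

/-- A set function is monotone if `f A ≤ f B` whenever `A ⊆ B`. -/
def IsMonotoneFn {U : Type*} [DecidableEq U] (f : Finset U → ℝ) : Prop :=
  ∀ A B : Finset U, A ⊆ B → f A ≤ f B

/-- The marginal gain `f(A | B) = f (A ∪ B) - f B`. -/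
def marg {U : Type*} [DecidableEq U] (f : Finset U → ℝ) (A B : Finset U) : ℝ :=
  f (A ∪ B) - f B

/-- The union of the first `n` sets of the family `X` (empty for `n = 0`). -/
def prefUnion {U : Type*} [DecidableEq U] {T : ℕ} (X : Fin T → Finset U) (n : ℕ) :
    Finset U :=
  (Finset.univ.filter (fun s : Fin T => (s : ℕ) < n)).biUnion X

/-- Marginal gains of a monotone submodular function are antitone in the base set. -/
theorem IsSubmodular.marg_anti {U : Type*} [DecidableEq U] {f : Finset U → ℝ}
    (hsub : IsSubmodular f) (hmono : IsMonotoneFn f) {A B : Finset U} (hAB : A ⊆ B)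
    (C : Finset U) : marg f C B ≤ marg f C A := by
  unfold marg
  induction C using Finset.induction_on with
  | empty => simp
  | insert e C _ ih =>
    rw [Finset.insert_union, Finset.insert_union]
    by_cases he : e ∈ C ∪ B
    · rw [Finset.insert_eq_of_mem he]
      have := hmono (C ∪ A) (insert e (C ∪ A)) (Finset.subset_insert _ _)
      linarith
    · have := hsub (C ∪ A) (C ∪ B) (Finset.union_subset_union_right hAB) e he
      linarith

theorem prefUnion_zero {U : Type*} [DecidableEq U] {T : ℕ} (X : Fin T → Finset U) :
    prefUnion X 0 = ∅ := by
  simp [prefUnion]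

theorem prefUnion_succ {U : Type*} [DecidableEq U] {T : ℕ} (X : Fin T → Finset U) (t : Fin T) :
    prefUnion X ((t : ℕ) + 1) = X t ∪ prefUnion X t := by
  have h : (Finset.univ.filter fun s : Fin T => (s : ℕ) < t + 1)
      = insert t (Finset.univ.filter fun s : Fin T => (s : ℕ) < t) := by
    ext s
    simp only [Finset.mem_filter, Finset.mem_univ, true_and, Finset.mem_insert, Fin.ext_iff]
    omega
  rw [prefUnion, h, Finset.biUnion_insert, prefUnion]

theorem prefUnion_self {U : Type*} [DecidableEq U] {T : ℕ} (X : Fin T → Finset U) :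
    prefUnion X T = Finset.univ.biUnion X := by
  simp [prefUnion]

/-- The bound on `f (⋃ P^t)` for every nonempty prefix of the two families. -/
theorem prefUnion_bound {U : Type*} [DecidableEq U] {f : Finset U → ℝ}
    (hmono : IsMonotoneFn f) (hsub : IsSubmodular f) {T : ℕ} (P G : Fin T → Finset U)
    (hsel : ∀ t : Fin T,
      marg f (P t) (prefUnion P (t : ℕ)) ≥ marg f (G t) (prefUnion P (t : ℕ)))
    (n : ℕ) (hn : n < T) :
    f (prefUnion G (n + 1))
        + ∑ t ∈ Finset.range n,
            (marg f (prefUnion P (t + 1)) (prefUnion G (t + 2))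
              - marg f (prefUnion P (t + 1)) (prefUnion G (t + 1)))
      ≤ f (prefUnion P (n + 1)) := by
  induction n with
  | zero =>
    have h := hsel ⟨0, hn⟩
    have hP := prefUnion_succ P ⟨0, hn⟩
    have hG := prefUnion_succ G ⟨0, hn⟩
    simp only [marg, prefUnion_zero, Finset.union_empty] at h hP hG
    rw [hP, hG]
    simpa using h
  | succ n ih =>
    have h := hsel ⟨n + 1, hn⟩
    have hP := prefUnion_succ P ⟨n + 1, hn⟩
    have hG := prefUnion_succ G ⟨n + 1, hn⟩
    have hanti := hsub.marg_anti hmono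
      (Finset.subset_union_left (s₁ := prefUnion P (n + 1)) (s₂ := prefUnion G (n + 1)))
      (G ⟨n + 1, hn⟩)
    have hunion : prefUnion P (n + 1) ∪ prefUnion G (n + 1 + 1)
        = G ⟨n + 1, hn⟩ ∪ (prefUnion P (n + 1) ∪ prefUnion G (n + 1)) := by
      rw [hG, Finset.union_left_comm]
    have ih := ih (by omega)
    rw [Finset.sum_range_succ]
    simp only [marg] at h hanti ih ⊢
    rw [← hP] at h
    rw [← hunion] at hanti
    linarith

/-- Induction lemma (Lemma 2 of the paper). If at each step `t`
the marginal gain of `P^t` over `⋃_{s<t} P^s` is at least that of `G^t`, then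
`f(⋃ P^t) ≥ f(⋃ G^t) + Σ_{t=1}^{T-1} [f(⋃_{s≤t} P^s | ⋃_{s≤t+1} G^s) - f(⋃_{s≤t} P^s | ⋃_{s≤t} G^s)]`. -/
theorem induction_lemma {U : Type*} [Fintype U] [DecidableEq U]
    (f : Finset U → ℝ) (hmono : IsMonotoneFn f) (hsub : IsSubmodular f)
    (T : ℕ) (hT : 1 ≤ T) (P G : Fin T → Finset U)
    (hsel : ∀ t : Fin T,
      marg f (P t) (prefUnion P (t : ℕ)) ≥ marg f (G t) (prefUnion P (t : ℕ))) :
    f (Finset.univ.biUnion P)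
      ≥ f (Finset.univ.biUnion G)
        + ∑ t ∈ Finset.range (T - 1),
            (marg f (prefUnion P (t + 1)) (prefUnion G (t + 2))
              - marg f (prefUnion P (t + 1)) (prefUnion G (t + 1))) := by
  obtain ⟨n, rfl⟩ : ∃ n, T = n + 1 := ⟨T - 1, by omega⟩
  have h := prefUnion_bound hmono hsub P G hsel n n.lt_succ_self
  rwa [prefUnion_self, prefUnion_self] at h
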